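/- The bounding number 𝔟 equals 𝔟₁, where 𝔟₁ is the least cardinal κ for which there exist a unital C*-algebra A of density character κ and a central sequence of unitaries (u_n)_{n∈ℕ} in A such that for every strictly increasing sequence (n(i))_{i∈ℕ} of natural numbers, setting v_k = u_{n(1)} u_{n(2)} ⋯ u_{n(k)}, the sequence of inner automorphisms (Ad v_k)_{k∈ℕ} does not converge pointwise in norm on A. -/

import Mathlib

/-- `g` eventually dominates `f`. -/
def EventuallyDominates (g f : ℕ → ℕ) : Prop :=
  ∀ᶠ n in Filter.atTop, f n ≤ g n

/-- The bounding number `𝔟`: the least cardinality of a family `F` of functions `ℕ → ℕ`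
such that no single `g : ℕ → ℕ` eventually dominates every member of `F`. -/
noncomputable def boundingNumber : Cardinal :=
  sInf { κ | ∃ F : Set (ℕ → ℕ), Cardinal.mk F = κ ∧
    ∀ g : ℕ → ℕ, ∃ f ∈ F, ¬ EventuallyDominates g f }

/-- The density character of a topological space: the least cardinality of a dense
subset. -/
noncomputable def densityCharacter (X : Type*) [TopologicalSpace X] : Cardinal :=
  sInf { κ | ∃ s : Set X, Dense s ∧ Cardinal.mk s = κ }

/-- A bounded sequence in a C*-algebra is central if it asymptotically commutes with
every element. -/
def IsCentralSequence {A : Type*} [CStarAlgebra A] (x : ℕ → A) : Prop :=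
  (∃ C : ℝ, ∀ n, ‖x n‖ ≤ C) ∧
    ∀ a : A, Filter.Tendsto (fun n => ‖x n * a - a * x n‖) Filter.atTop (nhds 0)

/-- There is a central sequence of unitaries `(u n)` such that for every strictly
increasing sequence `n : ℕ → ℕ`, the inner automorphisms
`Ad (u (n 0) * ⋯ * u (n (k-1)))` do not converge pointwise in norm on `A`. -/
def HasBadCentralUnitaries (A : Type*) [CStarAlgebra A] : Prop :=
  ∃ u : ℕ → A, (∀ k, u k ∈ unitary A) ∧ IsCentralSequence u ∧
    ∀ n : ℕ → ℕ, StrictMono n →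
      ¬ ∀ a : A, ∃ L : A, Filter.Tendsto
        (fun k => ((List.range k).map (fun i => u (n i))).prod * a *
          star ((List.range k).map (fun i => u (n i))).prod)
        Filter.atTop (nhds L)

/-- The cardinal `𝔟₁`: the least density character of a unital C*-algebra carrying a
central sequence of unitaries no strictly increasing subsequence of which has pointwise
convergent products of inner automorphisms. -/
noncomputable def b1 : Cardinal :=
  sInf { κ | ∃ (A : Type) (_ : CStarAlgebra A),
    densityCharacter A = κ ∧ HasBadCentralUnitaries A }

open Filter Topology Cardinal

theorem densityCharacter_le_mk {X : Type*} [TopologicalSpace X] {s : Set X} (hs : Dense s) :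
    densityCharacter X ≤ #s :=
  csInf_le' ⟨s, hs, rfl⟩

theorem exists_dense_mk_eq_densityCharacter (X : Type*) [TopologicalSpace X] :
    ∃ s : Set X, Dense s ∧ #s = densityCharacter X :=
  csInf_mem (s := {κ | ∃ s : Set X, Dense s ∧ #s = κ}) ⟨_, Set.univ, dense_univ, rfl⟩

/-- A set of cardinality `#s ⊔ ℵ₀` is dense in the C⋆-algebra generated by `s`. -/
theorem densityCharacter_topologicalClosure_adjoin_le {B : Type} [CStarAlgebra B] (s : Set B) :
    densityCharacter (StarAlgebra.adjoin ℂ s).topologicalClosure ≤ #s ⊔ ℵ₀ := by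
  let q : ℕ → B := fun n => algebraMap ℂ B (TopologicalSpace.denseSeq ℂ n)
  let D : StarSubalgebra ℤ B := StarAlgebra.adjoin ℤ (s ∪ Set.range q)
  have hD : #D ≤ #s ⊔ ℵ₀ := by
    have hs : #(s ∪ Set.range q : Set B) ≤ #s ⊔ ℵ₀ :=
      (mk_union_le _ _).trans <| (add_le_max _ _).trans <|
        max_le (max_le le_sup_left (mk_range_le.trans (by simp))) le_sup_right
    have hstar : #(star (s ∪ Set.range q) : Set B) ≤ #s ⊔ ℵ₀ := by
      rw [← Set.image_star]
      exact mk_image_le.trans hs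
    refine (Algebra.cardinalMk_adjoin_le ℤ _).trans ?_
    refine max_le (max_le (by simp) ?_) le_sup_right
    exact (mk_union_le _ _).trans <| (add_le_max _ _).trans <|
      max_le (max_le hs hstar) le_sup_right
  let T : StarSubalgebra ℂ B :=
    { D.topologicalClosure with
      algebraMap_mem' := fun c => by
        change algebraMap ℂ B c ∈ closure (D : Set B)
        refine map_mem_closure (continuous_algebraMap ℂ B)
          (TopologicalSpace.denseRange_denseSeq ℂ c) ?_
        rintro _ ⟨n, rfl⟩
        exact StarAlgebra.subset_adjoin ℤ _ (Or.inr ⟨n, rfl⟩) }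
  have hT : (StarAlgebra.adjoin ℂ s).topologicalClosure ≤ T :=
    StarSubalgebra.topologicalClosure_minimal
      (StarAlgebra.adjoin_le fun x hx =>
        subset_closure (StarAlgebra.subset_adjoin ℤ _ (Or.inl hx)))
      isClosed_closure
  have hDS : ∀ x ∈ D, x ∈ (StarAlgebra.adjoin ℂ s).topologicalClosure := by
    let S : StarSubalgebra ℤ B :=
      { (StarAlgebra.adjoin ℂ s).topologicalClosure.toSubalgebra.restrictScalars ℤ with
        star_mem' := fun h => star_mem (s := (StarAlgebra.adjoin ℂ s).topologicalClosure) h }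
    have : D ≤ S := by
      refine StarAlgebra.adjoin_le ?_
      rintro x (hx | ⟨n, rfl⟩)
      · exact StarSubalgebra.le_topologicalClosure _ (StarAlgebra.subset_adjoin ℂ _ hx)
      · exact algebraMap_mem (StarAlgebra.adjoin ℂ s).topologicalClosure _
    exact this
  let i : D → (StarAlgebra.adjoin ℂ s).topologicalClosure := fun x => ⟨x, hDS x x.2⟩
  have hi : DenseRange i := by
    refine Subtype.dense_iff.2 fun x hx => ?_
    refine closure_mono ?_ (hT hx)
    intro y hy
    exact ⟨_, ⟨⟨y, hy⟩, rfl⟩, rfl⟩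
  exact (densityCharacter_le_mk hi).trans (mk_range_le.trans hD)

/-- The elements asymptotically commuting with a sequence of unitaries. -/
def asymptoticCommutant {B : Type*} [CStarAlgebra B] (u : ℕ → B) (hu : ∀ n, u n ∈ unitary B) :
    StarSubalgebra ℂ B where
  carrier := {a | Tendsto (fun n => ‖u n * a - a * u n‖) atTop (𝓝 0)}
  mul_mem' {a b} ha hb := by
    refine squeeze_zero (fun _ => norm_nonneg _) (fun n => ?_)
      (by simpa using (ha.mul_const ‖b‖).add (hb.const_mul ‖a‖))
    calc ‖u n * (a * b) - a * b * u n‖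
        = ‖(u n * a - a * u n) * b + a * (u n * b - b * u n)‖ := by congr 1; noncomm_ring
      _ ≤ _ := (norm_add_le _ _).trans (add_le_add (norm_mul_le _ _) (norm_mul_le _ _))
  add_mem' {a b} ha hb := by
    refine squeeze_zero (fun _ => norm_nonneg _) (fun n => ?_) (by simpa using ha.add hb)
    calc ‖u n * (a + b) - (a + b) * u n‖
        = ‖(u n * a - a * u n) + (u n * b - b * u n)‖ := by congr 1; noncomm_ring
      _ ≤ _ := norm_add_le _ _
  algebraMap_mem' c := by
    simp [Algebra.commutes c]
  star_mem' {a} ha := by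
    refine ha.congr fun n => ?_
    have h : u n * star a - star a * u n = u n * star (u n * a - a * u n) * u n := by
      have h1 := Unitary.star_mul_self_of_mem (hu n)
      have h2 := Unitary.mul_star_self_of_mem (hu n)
      calc u n * star a - star a * u n
          = u n * star a * (star (u n) * u n) - (u n * star (u n)) * star a * u n := by
            rw [h1, h2]; simp
        _ = _ := by simp only [star_sub, star_mul]; noncomm_ring
    rw [h, CStarRing.norm_mul_mem_unitary _ (hu n), CStarRing.norm_mem_unitary_mul _ (hu n),
      norm_star]

theorem isClosed_asymptoticCommutant {B : Type*} [CStarAlgebra B] (u : ℕ → B)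
    (hu : ∀ n, u n ∈ unitary B) : IsClosed (asymptoticCommutant u hu : Set B) := by
  refine isClosed_of_closure_subset fun x hx => ?_
  change Tendsto (fun n => ‖u n * x - x * u n‖) atTop (𝓝 0)
  rw [Metric.tendsto_atTop]
  intro ε hε
  obtain ⟨a, ha, hxa⟩ := Metric.mem_closure_iff.1 hx (ε / 3) (by positivity)
  obtain ⟨N, hN⟩ := Metric.tendsto_atTop.1 ha (ε / 3) (by positivity)
  refine ⟨N, fun n hn => ?_⟩
  have h := hN n hn
  rw [dist_eq_norm] at hxa
  rw [Real.dist_0_eq_abs, abs_norm] at h ⊢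
  calc ‖u n * x - x * u n‖
      = ‖u n * (x - a) - (x - a) * u n + (u n * a - a * u n)‖ := by congr 1; noncomm_ring
    _ ≤ ‖u n * (x - a)‖ + ‖(x - a) * u n‖ + ‖u n * a - a * u n‖ :=
        (norm_add_le _ _).trans (by gcongr; exact norm_sub_le _ _)
    _ < ε := by
        rw [CStarRing.norm_mul_mem_unitary _ (hu n), CStarRing.norm_mem_unitary_mul _ (hu n)]
        linarith

theorem prod_map_range_mem_unitary {A : Type*} [Monoid A] [StarMul A] {u : ℕ → A}
    (hu : ∀ k, u k ∈ unitary A) (n : ℕ → ℕ) (k : ℕ) :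
    ((List.range k).map fun i => u (n i)).prod ∈ unitary A :=
  list_prod_mem (by simp [hu])

/-- Successive conjugates by partial products differ by the norm of a commutator. -/
theorem dist_conj_prod_succ {A : Type*} [CStarAlgebra A] {u : ℕ → A}
    (hu : ∀ k, u k ∈ unitary A) (n : ℕ → ℕ) (a : A) (k : ℕ) :
    dist (((List.range k).map (fun i => u (n i))).prod * a *
        star ((List.range k).map (fun i => u (n i))).prod)
      (((List.range (k + 1)).map (fun i => u (n i))).prod * a *
        star ((List.range (k + 1)).map (fun i => u (n i))).prod) =
      ‖u (n k) * a - a * u (n k)‖ := by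
  have hv := prod_map_range_mem_unitary hu n k
  simp only [List.range_succ, List.map_append, List.map_cons, List.map_nil, List.prod_append,
    List.prod_singleton]
  set v := ((List.range k).map (fun i => u (n i))).prod
  have h2 := Unitary.mul_star_self_of_mem (hu (n k))
  rw [dist_comm, dist_eq_norm]
  have h : v * u (n k) * a * star (v * u (n k)) - v * a * star v =
      v * ((u (n k) * a - a * u (n k)) * star (u (n k))) * star v := by
    calc _ = v * u (n k) * a * star (v * u (n k)) - v * a * (u (n k) * star (u (n k))) * star v := by
          rw [h2]; simp
      _ = _ := by simp only [star_mul]; noncomm_ring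
  rw [h, CStarRing.norm_mul_mem_unitary _ (Unitary.star_mem hv),
    CStarRing.norm_mem_unitary_mul _ hv,
    CStarRing.norm_mul_mem_unitary _ (Unitary.star_mem (hu _))]

/-- Conjugation by unitaries is equicontinuous, so pointwise convergence can be tested on a
dense set. -/
theorem exists_tendsto_conj_of_dense {A : Type*} [CStarAlgebra A] {v : ℕ → A}
    (hv : ∀ k, v k ∈ unitary A) {s : Set A} (hs : Dense s)
    (h : ∀ a ∈ s, CauchySeq fun k => v k * a * star (v k)) (a : A) :
    ∃ L, Tendsto (fun k => v k * a * star (v k)) atTop (𝓝 L) := by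
  refine cauchySeq_tendsto_of_complete (Metric.cauchySeq_iff.2 fun ε hε => ?_)
  obtain ⟨b, hb, hab⟩ := Metric.dense_iff.1 hs a (ε / 3) (by positivity)
  obtain ⟨N, hN⟩ := Metric.cauchySeq_iff.1 (h _ hab) (ε / 3) (by positivity)
  have key : ∀ k, dist (v k * a * star (v k)) (v k * b * star (v k)) < ε / 3 := fun k => by
    rw [dist_eq_norm, ← sub_mul, ← mul_sub,
      CStarRing.norm_mul_mem_unitary _ (Unitary.star_mem (hv k)),
      CStarRing.norm_mem_unitary_mul _ (hv k), ← dist_eq_norm, dist_comm]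
    exact hb
  refine ⟨N, fun m hm k hk => ?_⟩
  have h1 := key m
  have h2 := key k
  have h3 := hN m hm k hk
  have h4 := dist_triangle4 (v m * a * star (v m)) (v m * b * star (v m))
    (v k * b * star (v k)) (v k * a * star (v k))
  rw [dist_comm (v k * b * star (v k))] at h4
  linarith

theorem exists_strictMono_ge (g : ℕ → ℕ) : ∃ n : ℕ → ℕ, StrictMono n ∧ ∀ i, g i ≤ n i := by
  refine ⟨fun i => ∑ j ∈ Finset.range (i + 1), (g j + 1), strictMono_nat_of_lt_succ fun i => ?_,
    fun i => ?_⟩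
  · rw [Finset.sum_range_succ _ (i + 1)]
    omega
  · dsimp only
    rw [Finset.sum_range_succ]
    omega

theorem boundingNumber_le_densityCharacter {A : Type} [CStarAlgebra A]
    (hA : HasBadCentralUnitaries A) : boundingNumber ≤ densityCharacter A := by
  obtain ⟨u, hu, ⟨-, hc⟩, hbad⟩ := hA
  obtain ⟨s, hs, hsA⟩ := exists_dense_mk_eq_densityCharacter A
  have hf : ∀ (a : A) (i : ℕ), ∃ N, ∀ m ≥ N, ‖u m * a - a * u m‖ < (1 / 2) ^ i := by
    intro a i
    obtain ⟨N, hN⟩ := Metric.tendsto_atTop.1 (hc a) ((1 / 2) ^ i) (by positivity)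
    exact ⟨N, fun m hm => by simpa using hN m hm⟩
  choose f hf using hf
  rw [← hsA]
  refine le_trans (csInf_le' ⟨f '' s, rfl, fun g => ?_⟩) mk_image_le
  by_contra! hg
  obtain ⟨n, hn, hgn⟩ := exists_strictMono_ge g
  refine hbad n hn (exists_tendsto_conj_of_dense (prod_map_range_mem_unitary hu n) hs ?_)
  intro a ha
  obtain ⟨N, hN⟩ := eventually_atTop.1 (hg _ ⟨a, ha, rfl⟩)
  rw [← cauchySeq_shift N]
  refine cauchySeq_of_le_geometric (1 / 2) 1 (by norm_num) fun k => ?_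
  rw [add_right_comm, dist_conj_prod_succ hu]
  refine (hf a (k + N) _ ((hN _ (by omega)).trans (hgn _))).le.trans ?_
  rw [one_mul]
  exact pow_le_pow_of_le_one (by norm_num) (by norm_num) (by omega)

/-- A sequence of angles that escapes to infinity in steps of length at most one keeps
travelling around the circle. -/
theorem not_cauchySeq_exp_mul_I {S : ℕ → ℝ} (hmono : Monotone S) (hstep : ∀ k, S (k + 1) ≤ S k + 1)
    (hS : ∀ C, ∃ k, C ≤ S k) : ¬ CauchySeq fun k => Complex.exp (S k * Complex.I) := by
  intro hc
  obtain ⟨N, hN⟩ := Metric.cauchySeq_iff'.1 hc 1 one_pos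
  classical
  have hex := hS (S N + 2)
  obtain ⟨hj, hmin⟩ := (⟨Nat.find_spec hex, fun m hm => Nat.find_min hex hm⟩ :
    S N + 2 ≤ S (Nat.find hex) ∧ ∀ m < Nat.find hex, ¬ S N + 2 ≤ S m)
  set j := Nat.find hex
  have hNj : N < j := by
    by_contra! h
    linarith [hmono h]
  obtain ⟨i, hi⟩ : ∃ i, j = i + 1 := ⟨j - 1, by omega⟩
  have hlt : S j < S N + 3 := by
    have h1 := hmin i (by omega)
    have h2 := hstep i
    rw [hi]
    linarith
  have hdist := hN j hNj.le
  have hfac : Complex.exp (S j * Complex.I) - Complex.exp (S N * Complex.I) =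
      Complex.exp (S N * Complex.I) * (Complex.exp ((S j - S N : ℝ) * Complex.I) - 1) := by
    rw [mul_sub, ← Complex.exp_add, mul_one]
    congr 2
    push_cast
    ring
  rw [dist_eq_norm, hfac, norm_mul, Complex.norm_exp_ofReal_mul_I, one_mul] at hdist
  have hre := Complex.abs_re_le_norm (Complex.exp ((S j - S N : ℝ) * Complex.I) - 1)
  rw [Complex.sub_re, Complex.exp_ofReal_mul_I_re, Complex.one_re] at hre
  have hcos : Real.cos (S j - S N) ≤ 0 :=
    Real.cos_nonpos_of_pi_div_two_le_of_le (by linarith [Real.pi_le_four])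
      (by linarith [Real.pi_gt_three])
  linarith [neg_abs_le (Real.cos (S j - S N) - 1)]

/-- A null sequence decaying the more slowly the faster `f` grows. -/
noncomputable def slowAngle (f : ℕ → ℕ) (n : ℕ) : ℝ :=
  1 / ((sInf {j | n < f j + j} : ℕ) + 1)

theorem slowAngle_nonneg (f : ℕ → ℕ) (n : ℕ) : 0 ≤ slowAngle f n := by
  unfold slowAngle
  positivity

theorem slowAngle_le_one (f : ℕ → ℕ) (n : ℕ) : slowAngle f n ≤ 1 :=
  div_le_one_of_le₀ (by simp) (by positivity)

theorem le_slowAngle {f : ℕ → ℕ} {n m : ℕ} (h : n < f m + m) :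
    1 / ((m : ℝ) + 1) ≤ slowAngle f n := by
  unfold slowAngle
  gcongr
  exact Nat.sInf_le h

theorem tendsto_slowAngle (f : ℕ → ℕ) : Tendsto (slowAngle f) atTop (𝓝 0) := by
  refine (tendsto_one_div_add_atTop_nhds_zero_nat (𝕜 := ℝ)).comp (tendsto_atTop.2 fun m => ?_)
  filter_upwards [eventually_ge_atTop (∑ j ∈ Finset.range m, (f j + j))] with n hn
  refine le_csInf ⟨n + 1, by simp only [Set.mem_ofPred_eq]; omega⟩ fun j hj => ?_
  by_contra! hjm
  have := Finset.single_le_sum (f := fun j => f j + j) (fun _ _ => Nat.zero_le _)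
    (Finset.mem_range.2 hjm)
  exact absurd hj (by simp only [Set.mem_ofPred_eq]; omega)

theorem exists_le_sum_slowAngle {f n : ℕ → ℕ} (hn : StrictMono n)
    (h : ¬ EventuallyDominates (fun m => n ((m + 1) ^ 2)) f) (C : ℝ) :
    ∃ k, C ≤ ∑ i ∈ Finset.range k, slowAngle f (n i) := by
  obtain ⟨M, hM⟩ := exists_nat_ge C
  obtain ⟨m, hm, hfm⟩ := frequently_atTop.1 (not_eventually.1 h) M
  refine ⟨(m + 1) ^ 2, ?_⟩
  calc C ≤ (m : ℝ) + 1 := by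
        have : (M : ℝ) ≤ m := by exact_mod_cast hm
        linarith
    _ = ∑ i ∈ Finset.range ((m + 1) ^ 2), 1 / ((m : ℝ) + 1) := by
        rw [Finset.sum_const, Finset.card_range, nsmul_eq_mul]
        push_cast
        field_simp
    _ ≤ _ := Finset.sum_le_sum fun i hi => le_slowAngle (by
        have := hn (Finset.mem_range.1 hi)
        dsimp only at hfm
        omega)

/-- Commuting unitaries rotating each `a x` through prescribed angles. -/
theorem exists_rotating_unitaries {ι : Type} (θ : ι → ℕ → ℝ) :
    ∃ (B : Type) (_ : CStarAlgebra B) (u : ℕ → B) (a : ι → B), (∀ n, u n ∈ unitary B) ∧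
      (∀ m n, u m * u n = u n * u m) ∧ (∀ x, a x ≠ 0) ∧
      (∀ x n, u n * a x = Complex.exp (θ x n * Complex.I) • a x) ∧ ∀ x n, a x * u n = a x := by
  classical
  open scoped Matrix.Norms.L2Operator in
  let _ : TopologicalSpace ι := ⊥
  have : DiscreteTopology ι := ⟨rfl⟩
  let w : ℝ → Matrix (Fin 2) (Fin 2) ℂ := fun t => !![Complex.exp (t * Complex.I), 0; 0, 1]
  let e : Matrix (Fin 2) (Fin 2) ℂ := !![0, 1; 0, 0]
  have hstar : ∀ t, star (w t) = w (-t) := fun t => by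
    ext i j
    fin_cases i <;> fin_cases j <;>
      simp [w, Matrix.star_apply, ← Complex.exp_conj]
  have hmul : ∀ s t, w s * w t = w (s + t) := fun s t => by
    simp [w, ← Complex.exp_add, add_mul]
  have hzero : w 0 = 1 := by simp [w, Matrix.one_fin_two]
  have hw : ∀ t, w t ∈ unitary (Matrix (Fin 2) (Fin 2) ℂ) := fun t => by
    rw [Unitary.mem_iff, hstar, hmul, hmul]
    simp [hzero]
  have hwe : ∀ t, w t * e = Complex.exp (t * Complex.I) • e := fun t => by
    simp [w, e, Matrix.smul_of]
  have hew : ∀ t, e * w t = e := fun t => by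
    rw [Matrix.mul_fin_two]
    simp [e]
  have he : e ≠ 0 := fun h => by simpa [e] using congrFun₂ h 0 1
  let u : ℕ → BoundedContinuousFunction ι (Matrix (Fin 2) (Fin 2) ℂ) := fun n =>
    BoundedContinuousFunction.ofNormedAddCommGroupDiscrete (fun x => w (θ x n)) 1
      fun x => (CStarRing.norm_of_mem_unitary (hw _)).le
  let a : ι → BoundedContinuousFunction ι (Matrix (Fin 2) (Fin 2) ℂ) := fun x =>
    BoundedContinuousFunction.ofNormedAddCommGroupDiscrete (Pi.single x e) ‖e‖ fun y => by
      by_cases h : y = x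
      · subst h; simp
      · simp [h]
  refine ⟨BoundedContinuousFunction ι (Matrix (Fin 2) (Fin 2) ℂ), inferInstance, u, a,
    fun n => ?_, fun m n => ?_, fun x h => ?_, fun x n => ?_, fun x n => ?_⟩
  · rw [Unitary.mem_iff]
    constructor
    · ext1 x
      exact (hw (θ x n)).1
    · ext1 x
      exact (hw (θ x n)).2
  · ext1 x
    change w _ * w _ = w _ * w _
    rw [hmul, hmul, add_comm]
  · refine he ?_
    have := DFunLike.congr_fun h x
    simpa [a] using this
  · ext1 y
    rw [BoundedContinuousFunction.mul_apply, BoundedContinuousFunction.smul_apply]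
    change w (θ y n) * (Pi.single x e : ι → _) y = _ • (Pi.single x e : ι → _) y
    by_cases h : y = x
    · subst h
      simp [hwe]
    · simp [h]
  · ext1 y
    change (Pi.single x e : ι → _) y * w (θ y n) = (Pi.single x e : ι → _) y
    by_cases h : y = x
    · subst h
      simp [hew]
    · simp [h]

theorem conj_prod_eq_smul {A : Type*} [CStarAlgebra A] {u : ℕ → A} {a : A}
    (hu : ∀ n, u n ∈ unitary A) {θ : ℕ → ℝ}
    (hua : ∀ n, u n * a = Complex.exp (θ n * Complex.I) • a) (hau : ∀ n, a * u n = a)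
    (n : ℕ → ℕ) (k : ℕ) :
    ((List.range k).map (fun i => u (n i))).prod * a *
        star ((List.range k).map (fun i => u (n i))).prod =
      Complex.exp ((∑ i ∈ Finset.range k, θ (n i) : ℝ) * Complex.I) • a := by
  have hau' : ∀ m, a * star (u m) = a := fun m => by
    conv_lhs => rw [← hau m]
    rw [mul_assoc, Unitary.mul_star_self_of_mem (hu m), mul_one]
  induction k with
  | zero => simp
  | succ k ih =>
    simp only [List.range_succ, List.map_append, List.map_cons, List.map_nil, List.prod_append,
      List.prod_singleton, star_mul]
    rw [mul_assoc _ (u (n k)), hua, mul_smul_comm, smul_mul_assoc, ← mul_assoc,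
      mul_assoc _ a, hau', ih, smul_smul, ← Complex.exp_add, Finset.sum_range_succ]
    congr 2
    push_cast
    ring

theorem exists_hasBadCentralUnitaries {ι : Type} (f : ι → ℕ → ℕ)
    (hf : ∀ g, ∃ x, ¬ EventuallyDominates g (f x)) :
    ∃ (A : Type) (_ : CStarAlgebra A), densityCharacter A ≤ #ι ⊔ ℵ₀ ∧
      HasBadCentralUnitaries A := by
  obtain ⟨B, _, u, a, hu, huu, ha, hua, hau⟩ := exists_rotating_unitaries fun x => slowAngle (f x)
  let s : Set B := Set.range u ∪ Set.range a
  let S : StarSubalgebra ℂ B := (StarAlgebra.adjoin ℂ s).topologicalClosure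
  have hsS : s ⊆ S := (StarAlgebra.subset_adjoin ℂ s).trans (StarSubalgebra.le_topologicalClosure _)
  have hSC : S ≤ asymptoticCommutant u hu := by
    refine StarSubalgebra.topologicalClosure_minimal (StarAlgebra.adjoin_le ?_)
      (isClosed_asymptoticCommutant u hu)
    rintro _ (⟨m, rfl⟩ | ⟨x, rfl⟩)
    · change Tendsto (fun n => ‖u n * u m - u m * u n‖) atTop (𝓝 0)
      simp [huu _ m]
    · change Tendsto (fun n => ‖u n * a x - a x * u n‖) atTop (𝓝 0)
      simp only [hua, hau]
      have hcont : Continuous fun t : ℝ => ‖Complex.exp (t * Complex.I) • a x - a x‖ := by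
        fun_prop
      simpa [Function.comp_def] using (hcont.tendsto 0).comp (tendsto_slowAngle (f x))
  have : IsClosed (S : Set B) := StarSubalgebra.isClosed_topologicalClosure _
  have huS : ∀ n, u n ∈ S := fun n => hsS (Or.inl ⟨n, rfl⟩)
  have haS : ∀ x, a x ∈ S := fun x => hsS (Or.inr ⟨x, rfl⟩)
  have hu' : ∀ n, (⟨u n, huS n⟩ : S) ∈ unitary S := fun n =>
    ⟨Subtype.ext (hu n).1, Subtype.ext (hu n).2⟩
  refine ⟨S, inferInstance, ?_, fun n => ⟨u n, huS n⟩, hu', ⟨⟨‖(1 : S)‖, fun n => ?_⟩, fun b => ?_⟩,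
    fun n hn hconv => ?_⟩
  · refine (densityCharacter_topologicalClosure_adjoin_le s).trans (max_le ?_ le_sup_right)
    exact (mk_union_le _ _).trans <| (add_le_max _ _).trans <|
      max_le (max_le (mk_range_le.trans (by simp)) (mk_range_le.trans le_sup_left)) le_sup_right
  · have := CStarRing.norm_mem_unitary_mul (1 : S) (hu' n)
    rw [mul_one] at this
    exact this.le
  · exact hSC b.2
  · obtain ⟨x, hx⟩ := hf fun m => n ((m + 1) ^ 2)
    obtain ⟨L, hL⟩ := hconv ⟨a x, haS x⟩
    refine not_cauchySeq_exp_mul_I (S := fun k => ∑ i ∈ Finset.range k, slowAngle (f x) (n i))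
      (monotone_nat_of_le_succ fun k => ?_) (fun k => ?_) (exists_le_sum_slowAngle hn hx) ?_
    · rw [Finset.sum_range_succ]
      linarith [slowAngle_nonneg (f x) (n k)]
    · rw [Finset.sum_range_succ]
      linarith [slowAngle_le_one (f x) (n k)]
    · have hL' := hL.cauchySeq
      simp only [conj_prod_eq_smul (a := (⟨a x, haS x⟩ : S)) hu'
        (fun m => Subtype.ext (hua x m)) (fun m => Subtype.ext (hau x m))] at hL'
      have hpos : 0 < ‖a x‖ := norm_pos_iff.2 (ha x)
      refine Metric.cauchySeq_iff.2 fun ε hε => ?_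
      obtain ⟨N, hN⟩ := Metric.cauchySeq_iff.1 hL' (ε * ‖a x‖) (by positivity)
      refine ⟨N, fun i hi j hj => ?_⟩
      have := hN i hi j hj
      rw [dist_eq_norm, ← sub_smul, norm_smul] at this
      rw [dist_eq_norm]
      exact lt_of_mul_lt_mul_right this hpos.le

theorem exists_unbounded_family_mk_eq_boundingNumber :
    ∃ F : Set (ℕ → ℕ), #F = boundingNumber ∧ ∀ g, ∃ f ∈ F, ¬ EventuallyDominates g f := by
  refine csInf_mem (s := {κ | ∃ F : Set (ℕ → ℕ), #F = κ ∧
    ∀ g : ℕ → ℕ, ∃ f ∈ F, ¬ EventuallyDominates g f}) ⟨_, Set.univ, rfl, fun g => ?_⟩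
  refine ⟨fun n => g n + 1, Set.mem_univ _, fun h => ?_⟩
  obtain ⟨n, hn⟩ := h.exists
  exact Nat.not_succ_le_self _ hn

theorem infinite_of_unbounded {F : Set (ℕ → ℕ)}
    (hF : ∀ g, ∃ f ∈ F, ¬ EventuallyDominates g f) : F.Infinite := by
  intro hfin
  obtain ⟨f, hf, hnot⟩ := hF fun n => ∑ f ∈ hfin.toFinset, f n
  exact hnot (Eventually.of_forall fun n =>
    Finset.single_le_sum (f := fun f : ℕ → ℕ => f n) (fun _ _ => Nat.zero_le _)
      (hfin.mem_toFinset.2 hf))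

/-- `𝔟 = 𝔟₁`. -/
theorem stmt_10 : boundingNumber = b1 := by
  obtain ⟨F, hFb, hF⟩ := exists_unbounded_family_mk_eq_boundingNumber
  obtain ⟨A, _, hdens, hbad⟩ := exists_hasBadCentralUnitaries (fun f : F => (f : ℕ → ℕ))
    (by simpa using hF)
  refine le_antisymm (le_csInf ⟨_, A, _, rfl, hbad⟩ ?_) ?_
  · rintro _ ⟨A, _, rfl, hA⟩
    exact boundingNumber_le_densityCharacter hA
  · refine (show b1 ≤ densityCharacter A from csInf_le' ⟨A, _, rfl, hbad⟩).trans (hdens.trans (max_le hFb.le ?_))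
    rw [← hFb, aleph0_le_mk_iff]
    exact (infinite_of_unbounded hF).to_subtype
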